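/- For any LTS and processes p, q: p is ready-simulated by q (there is a ready simulation R with p R q) if and only if every ready simulation observation satisfied by p is also satisfied by q. -/

import Mathlib

def Sim {P A : Type} (tr : P → A → P → Prop) (R : P → P → Prop) : Prop :=
  ∀ p q, R p q → ∀ a p', tr p a p' → ∃ q', tr q a q' ∧ R p' q'

def Bisim {P A : Type} (tr : P → A → P → Prop) (R : P → P → Prop) : Prop :=
  Sim tr R ∧ Sim tr (fun p q => R q p)

def ReadySim {P A : Type} (tr : P → A → P → Prop) (R : P → P → Prop) : Prop :=
  Sim tr R ∧ ∀ p q, R p q → ∀ a, (∀ p', ¬ tr p a p') → ∀ q', ¬ tr q a q'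

def initials {P A : Type} (tr : P → A → P → Prop) (p : P) : Set A :=
  {a | ∃ p', tr p a p'}

inductive Steps {P A : Type} (tr : P → A → P → Prop) : P → List A → P → Prop where
  | nil (p : P) : Steps tr p [] p
  | cons {p : P} {a : A} {p' : P} {l : List A} {q : P} :
      tr p a p' → Steps tr p' l q → Steps tr p (a :: l) q

def Trace {P A : Type} (tr : P → A → P → Prop) (p : P) (ς : List A) : Prop :=
  ∃ q, Steps tr p ς q

def CompletedTrace {P A : Type} (tr : P → A → P → Prop) (p : P) (ς : List A) : Prop :=
  ∃ q, Steps tr p ς q ∧ initials tr q = ∅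

def ReadyPair {P A : Type} (tr : P → A → P → Prop) (p : P) (ς : List A) (X : Set A) : Prop :=
  ∃ q, Steps tr p ς q ∧ initials tr q = X

def FailurePair {P A : Type} (tr : P → A → P → Prop) (p : P) (ς : List A) (X : Set A) : Prop :=
  ∃ q, Steps tr p ς q ∧ initials tr q ∩ X = ∅

inductive ReadyTrace {P A : Type} (tr : P → A → P → Prop) : P → Set A → List (A × Set A) → Prop where
  | nil (p : P) : ReadyTrace tr p (initials tr p) []
  | cons {p : P} {a : A} {p' : P} {X : Set A} {rest : List (A × Set A)} :
      tr p a p' → ReadyTrace tr p' X rest → ReadyTrace tr p (initials tr p) ((a, X) :: rest)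

inductive FailureTrace {P A : Type} (tr : P → A → P → Prop) : P → Set A → List (A × Set A) → Prop where
  | nil {p : P} {X : Set A} : initials tr p ∩ X = ∅ → FailureTrace tr p X []
  | cons {p : P} {a : A} {p' : P} {X Y : Set A} {rest : List (A × Set A)} :
      initials tr p ∩ X = ∅ → tr p a p' → FailureTrace tr p' Y rest →
      FailureTrace tr p X ((a, Y) :: rest)

inductive Obs (A : Type) : Type 1 where
  | top : Obs A
  | act : A → Obs A → Obs A
  | refuse : A → Obs A
  | conj : {ι : Type} → (ι → Obs A) → Obs A

def Sat {P A : Type} (tr : P → A → P → Prop) : P → Obs A → Prop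
  | _, .top => True
  | p, .act a φ => ∃ q, tr p a q ∧ Sat tr q φ
  | p, .refuse a => ∀ q, ¬ tr p a q
  | p, .conj φs => ∀ i, Sat tr p (φs i)

inductive IsT {A : Type} : Obs A → Prop where
  | top : IsT .top
  | act (a : A) {φ : Obs A} : IsT φ → IsT (.act a φ)

inductive IsCT {A : Type} : Obs A → Prop where
  | top : IsCT .top
  | act (a : A) {φ : Obs A} : IsCT φ → IsCT (.act a φ)
  | refuseAll : IsCT (.conj (fun a : A => Obs.refuse a))

inductive IsF {A : Type} : Obs A → Prop where
  | top : IsF .top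
  | act (a : A) {φ : Obs A} : IsF φ → IsF (.act a φ)
  | conj {I : Type} (as : I → A) : IsF (.conj (fun i => Obs.refuse (as i)))

inductive IsR {A : Type} : Obs A → Prop where
  | top : IsR .top
  | act (a : A) {φ : Obs A} : IsR φ → IsR (.act a φ)
  | conj {I J : Type} (as : I → A) (bs : J → A) :
      IsR (.conj (Sum.elim (fun i => Obs.refuse (as i)) (fun j => Obs.act (bs j) Obs.top)))

inductive IsFT {A : Type} : Obs A → Prop where
  | top : IsFT .top
  | act (a : A) {φ : Obs A} : IsFT φ → IsFT (.act a φ)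
  | conj {I : Type} (as : I → A) {φ : Obs A} : IsFT φ →
      IsFT (.conj (Sum.elim (fun i => Obs.refuse (as i)) (fun _ : PUnit => φ)))

inductive IsRT {A : Type} : Obs A → Prop where
  | top : IsRT .top
  | act (a : A) {φ : Obs A} : IsRT φ → IsRT (.act a φ)
  | conj {I J : Type} (as : I → A) (bs : J → A) {φ : Obs A} : IsRT φ →
      IsRT (.conj (Sum.elim (Sum.elim (fun i => Obs.refuse (as i)) (fun j => Obs.act (bs j) Obs.top)) (fun _ : PUnit => φ)))

inductive IsRS {A : Type} : Obs A → Prop where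
  | top : IsRS .top
  | act (a : A) {φ : Obs A} : IsRS φ → IsRS (.act a φ)
  | refuse (a : A) : IsRS (.refuse a)
  | conj {ι : Type} {φs : ι → Obs A} : (∀ i, IsRS (φs i)) → IsRS (.conj φs)

def Wedge {A : Type} (L : Obs A → Prop) : Obs A → Prop :=
  fun φ => ∃ (ι : Type) (φs : ι → Obs A), (∀ i, L (φs i)) ∧ φ = Obs.conj φs

def ObsLe {P A : Type} (tr : P → A → P → Prop) (L : Obs A → Prop) (p q : P) : Prop :=
  ∀ φ : Obs A, L φ → Sat tr p φ → Sat tr q φ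

def NestedSim {P A : Type} (tr : P → A → P → Prop) : ℕ → (P → P → Prop) → Prop
  | 0, _ => False
  | 1, R => Sim tr R
  | (n+2), R => Sim tr R ∧ ∃ S, NestedSim tr (n+1) S ∧ ∀ p q, R p q → S q p

/-- modal characterization of the ready simulation preorder. -/
theorem ready_simulation_modal_characterization
    (P A : Type) (tr : P → A → P → Prop) (p q : P) :
    (∃ R, ReadySim tr R ∧ R p q) ↔
      (∀ φ : Obs A, IsRS φ → Sat tr p φ → Sat tr q φ) := by
  constructor
  · rintro ⟨R, ⟨hS, hR⟩, hpq⟩ φ hφ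
    induction hφ generalizing p q with
    | top => intro _; simp [Sat]
    | act a _ ih =>
      intro h
      simp only [Sat] at h ⊢
      obtain ⟨p', ht, hp'⟩ := h
      obtain ⟨q', hq, hr⟩ := hS p q hpq a p' ht
      exact ⟨q', hq, ih p' q' hr hp'⟩
    | refuse a =>
      intro h
      simp only [Sat] at h ⊢
      exact hR p q hpq a h
    | conj _ ih =>
      intro h
      simp only [Sat] at h ⊢
      exact fun i => ih i p q hpq (h i)
  · intro h
    refine ⟨fun p q => ∀ φ : Obs A, IsRS φ → Sat tr p φ → Sat tr q φ, ⟨?_, ?_⟩, h⟩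
    · intro p q hpq a p' ht
      by_contra hcon
      have hx : ∀ x : {q' // tr q a q'}, ∃ φ : Obs A, IsRS φ ∧ Sat tr p' φ ∧ ¬ Sat tr x.1 φ := by
        intro x
        by_contra hx
        refine hcon ⟨x.1, x.2, fun φ h1 h2 => ?_⟩
        by_contra h3
        exact hx ⟨φ, h1, h2, h3⟩
      choose f hf1 hf2 hf3 using hx
      have key := hpq (.act a (.conj f)) (.act a (.conj hf1))
      simp only [Sat] at key
      obtain ⟨q', hq', hs⟩ := key ⟨p', ht, hf2⟩
      exact hf3 ⟨q', hq'⟩ (hs ⟨q', hq'⟩)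
    · intro p q hpq a hp
      have key := hpq (.refuse a) (.refuse a)
      simp only [Sat] at key
      exact key hp
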